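/- Let λ ≠ 0, γ = 1/λ, let b₁, v₁, α ∈ ℝ with v₁·α ≠ 0, and let g ∈ ℝ[t] be a polynomial with g(0) = 0 and deg g ≥ 1. Define P(x,y,z) = (−γ·g(s), −γ²v₁z + γ(b₁ + 2γv₁αx)·g(s) − γ²v₁α·g(s)², −αγ·g(s)²) with s = γy + γb₁x + γ²v₁αx² − γ²v₁z, and let T : ℝ³ → ℝ³ be the invertible linear map T(x,y,z) = (x, y − γv₁z, z). Then T ∘ (γ·id + P) ∘ T⁻¹ = γ·id + P̂, where P̂(x,y,z) = (−γ·g(s′), −γ²v₁z + γ(b₁ + 2γv₁αx)·g(s′), −αγ·g(s′)²) with s′ = γy + γb₁x + γ²v₁αx². Moreover, setting u = P̂₁ and v = P̂₂, A = vₓ·u_z − uₓ·v_z and B = v_y·u_z − u_y·v_z, one has deg_z(u·A) ≠ deg_z(v·B). -/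

import Mathlib

open MvPolynomial

namespace MvPolynomial

variable {σ R : Type*} [CommSemiring R]

theorem pderiv_polynomial_aeval (i : σ) (p : MvPolynomial σ R) (g : Polynomial R) :
    pderiv i (Polynomial.aeval p g) =
      Polynomial.aeval p (Polynomial.derivative g) * pderiv i p := by
  rw [Derivation.map_aeval, smul_eq_mul]

theorem degreeOf_eq_zero_of_mem_supported {s : Set σ} {i : σ} {p : MvPolynomial σ R}
    (hp : p ∈ supported R s) (hi : i ∉ s) : degreeOf i p = 0 := by
  classical
  rw [degreeOf_def, Multiset.count_eq_zero, ← Multiset.mem_toFinset, ← vars_def]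
  exact fun h => hi (mem_supported.mp hp h)

theorem pderiv_eq_zero_of_degreeOf_eq_zero {i : σ} {p : MvPolynomial σ R}
    (h : degreeOf i p = 0) : pderiv i p = 0 := by
  classical
  apply pderiv_eq_zero_of_notMem_vars
  rwa [vars_def, Multiset.mem_toFinset, ← Multiset.count_eq_zero, ← degreeOf_def]

theorem pderiv_eq_zero_of_mem_supported {s : Set σ} {i : σ} {p : MvPolynomial σ R}
    (hp : p ∈ supported R s) (hi : i ∉ s) : pderiv i p = 0 :=
  pderiv_eq_zero_of_degreeOf_eq_zero (degreeOf_eq_zero_of_mem_supported hp hi)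

theorem eval_polynomial_aeval (x : σ → R) (p : MvPolynomial σ R) (g : Polynomial R) :
    eval x (Polynomial.aeval p g) = g.eval (eval x p) := by
  rw [Polynomial.aeval_def, Polynomial.hom_eval₂, Polynomial.eval₂_eq_eval_map]
  congr 1
  convert Polynomial.map_id
  ext r
  simp

end MvPolynomial

/-- Under the linear change of coordinates `T(x,y,z) = (x, y - γv₁z, z)`,
the map `γ·id + P` is conjugated into `γ·id + P̂`, and the components `u = P̂₁`, `v = P̂₂`
satisfy `deg_z(u·A) ≠ deg_z(v·B)`. -/
theorem stmt6 (lam γ b₁ v₁ α : ℝ) (hlam : lam ≠ 0) (hγ : γ = 1 / lam)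
    (hv₁α : v₁ * α ≠ 0) (g : Polynomial ℝ) (hg0 : g.eval 0 = 0) (hgdeg : 1 ≤ g.natDegree)
    (s shat : MvPolynomial (Fin 3) ℝ)
    (hs : s = C γ * X 1 + C (γ * b₁) * X 0 + C (γ ^ 2 * v₁ * α) * X 0 ^ 2
            - C (γ ^ 2 * v₁) * X 2)
    (hshat : shat = C γ * X 1 + C (γ * b₁) * X 0 + C (γ ^ 2 * v₁ * α) * X 0 ^ 2)
    (P Phat : Fin 3 → MvPolynomial (Fin 3) ℝ)
    (hP : P = ![C (-γ) * Polynomial.aeval s g,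
                C (-(γ ^ 2 * v₁)) * X 2
                  + C γ * (C b₁ + C (2 * γ * v₁ * α) * X 0) * Polynomial.aeval s g
                  - C (γ ^ 2 * v₁ * α) * (Polynomial.aeval s g) ^ 2,
                C (-(α * γ)) * (Polynomial.aeval s g) ^ 2])
    (hPhat : Phat = ![C (-γ) * Polynomial.aeval shat g,
                      C (-(γ ^ 2 * v₁)) * X 2
                        + C γ * (C b₁ + C (2 * γ * v₁ * α) * X 0) * Polynomial.aeval shat g,
                      C (-(α * γ)) * (Polynomial.aeval shat g) ^ 2])
    (T Tinv : (Fin 3 → ℝ) → (Fin 3 → ℝ))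
    (hT : ∀ p, T p = ![p 0, p 1 - γ * v₁ * p 2, p 2])
    (hTinv : ∀ p, Tinv p = ![p 0, p 1 + γ * v₁ * p 2, p 2])
    (A B : MvPolynomial (Fin 3) ℝ)
    (hA : A = pderiv 0 (Phat 1) * pderiv 2 (Phat 0) - pderiv 0 (Phat 0) * pderiv 2 (Phat 1))
    (hB : B = pderiv 1 (Phat 1) * pderiv 2 (Phat 0) - pderiv 1 (Phat 0) * pderiv 2 (Phat 1)) :
    (∀ p : Fin 3 → ℝ,
      T (fun i => γ * Tinv p i + eval (Tinv p) (P i)) = fun i => γ * p i + eval p (Phat i)) ∧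
    degreeOf 2 (Phat 0 * A) ≠ degreeOf 2 (Phat 1 * B) := by
  have hγ0 : γ ≠ 0 := by rw [hγ]; exact one_div_ne_zero hlam
  have hv₁ : v₁ ≠ 0 := left_ne_zero_of_mul hv₁α
  constructor
  · intro p
    have key : eval (Tinv p) s = eval p shat := by
      simp [hs, hshat, hTinv]
      ring
    funext i
    fin_cases i <;>
      simp [hT, hP, hPhat, eval_polynomial_aeval, key] <;> simp [hTinv]
    ring
  · have hX0 : (X 0 : MvPolynomial (Fin 3) ℝ) ∈ supported ℝ {0, 1} :=
      X_mem_supported.mpr (by simp)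
    have hX1 : (X 1 : MvPolynomial (Fin 3) ℝ) ∈ supported ℝ {0, 1} :=
      X_mem_supported.mpr (by simp)
    have hC (c : ℝ) : (C c : MvPolynomial (Fin 3) ℝ) ∈ supported ℝ {0, 1} :=
      Subalgebra.algebraMap_mem _ c
    have h2 : (2 : Fin 3) ∉ ({0, 1} : Set (Fin 3)) := by decide
    have hshat_mem : shat ∈ supported ℝ {0, 1} := by
      rw [hshat]
      exact add_mem (add_mem (mul_mem (hC _) hX1) (mul_mem (hC _) hX0))
        (mul_mem (hC _) (pow_mem hX0 2))
    have haeval (q : Polynomial ℝ) : Polynomial.aeval shat q ∈ supported ℝ {0, 1} :=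
      Algebra.adjoin_le (Set.singleton_subset_iff.mpr hshat_mem)
        (Polynomial.aeval_mem_adjoin_singleton ℝ shat)
    have hu : Phat 0 = C (-γ) * Polynomial.aeval shat g := by simp [hPhat]
    have hu_mem : Phat 0 ∈ supported ℝ {0, 1} := hu ▸ mul_mem (hC _) (haeval g)
    have hu_z : pderiv 2 (Phat 0) = 0 := pderiv_eq_zero_of_mem_supported hu_mem h2
    have hv_z : pderiv 2 (Phat 1) = C (-(γ ^ 2 * v₁)) := by
      have hmem : C γ * (C b₁ + C (2 * γ * v₁ * α) * X 0) * Polynomial.aeval shat g ∈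
          supported ℝ {0, 1} :=
        mul_mem (mul_mem (hC _) (add_mem (hC _) (mul_mem (hC _) hX0))) (haeval g)
      have hv : Phat 1 = C (-(γ ^ 2 * v₁)) * X 2 +
          C γ * (C b₁ + C (2 * γ * v₁ * α) * X 0) * Polynomial.aeval shat g := by
        simp [hPhat]
      rw [hv, map_add, pderiv_eq_zero_of_mem_supported hmem h2, pderiv_C_mul, pderiv_X_self]
      simp
    have hu_x : pderiv 0 (Phat 0) = C (-γ) *
        (Polynomial.aeval shat (Polynomial.derivative g) *
          (C (γ * b₁) + C (γ ^ 2 * v₁ * α) * (2 * X 0))) := by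
      rw [hu, pderiv_C_mul, pderiv_polynomial_aeval]
      congr 2
      simp [hshat, pderiv_X]
    have hu_y : pderiv 1 (Phat 0) = C (-γ) *
        (Polynomial.aeval shat (Polynomial.derivative g) * C γ) := by
      rw [hu, pderiv_C_mul, pderiv_polynomial_aeval]
      congr 2
      simp [hshat, pderiv_X]
    have hA_mem : A ∈ supported ℝ {0, 1} := by
      rw [hA, hu_z, hv_z, mul_zero, hu_x]
      exact sub_mem (zero_mem _) (mul_mem (mul_mem (hC _) (mul_mem (haeval _)
        (add_mem (hC _) (mul_mem (hC _) (mul_mem (hC 2) hX0))))) (hC _))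
    have hB_mem : B ∈ supported ℝ {0, 1} := by
      rw [hB, hu_z, hv_z, mul_zero, hu_y]
      exact sub_mem (zero_mem _) (mul_mem (mul_mem (hC _) (mul_mem (haeval _) (hC _))) (hC _))
    have hg' : Polynomial.derivative g ≠ 0 := fun h => by
      have := Polynomial.derivative_eq_zero.mp h
      omega
    have haeval_ne : Polynomial.aeval shat (Polynomial.derivative g) ≠ 0 := by
      intro h
      let φ : MvPolynomial (Fin 3) ℝ →ₐ[ℝ] Polynomial ℝ :=
        aeval ![0, Polynomial.C γ⁻¹ * Polynomial.X, 0]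
      have hφ : φ shat = Polynomial.X := by
        have hC_mul : Polynomial.C γ * Polynomial.C γ⁻¹ = 1 := by
          rw [← Polynomial.C_mul, mul_inv_cancel₀ hγ0, Polynomial.C_1]
        simp [φ, hshat, Polynomial.algebraMap_eq, ← mul_assoc, hC_mul]
      apply hg'
      have := congrArg φ h
      rwa [← Polynomial.aeval_algHom_apply, hφ, Polynomial.aeval_X_left_apply, map_zero] at this
    have hc : (C (-(γ ^ 2 * v₁)) : MvPolynomial (Fin 3) ℝ) ≠ 0 := by simp [hγ0, hv₁]
    have hB_ne : B ≠ 0 := by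
      rw [hB, hu_z, hv_z, mul_zero, hu_y, zero_sub, neg_ne_zero]
      exact mul_ne_zero (mul_ne_zero (by simp [hγ0])
        (mul_ne_zero haeval_ne (by simp [hγ0]))) hc
    rw [degreeOf_eq_zero_of_mem_supported (mul_mem hu_mem hA_mem) h2]
    intro h
    have h0 := pderiv_eq_zero_of_degreeOf_eq_zero h.symm
    rw [pderiv_mul, pderiv_eq_zero_of_mem_supported hB_mem h2, hv_z, mul_zero, add_zero] at h0
    exact mul_ne_zero hc hB_ne h0
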